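/- For every σ > 2, the complement ℝ \ 𝓟𝓜 of the Perez-Marco set has zero Hausdorff H^{h²_σ}-measure with respect to the gauge function h²_σ(t) = (ln ln(1/t))^{-2} · (ln ln ln(1/t))^{-σ} for 0 < t ≤ e^{-10} (and h²_σ(0) = 0). -/

import Mathlib

open MeasureTheory Filter ENNReal

/-- The `n`-th denominator of the continued fraction expansion of `α`. -/
noncomputable def cfDen (α : ℝ) (n : ℕ) : ℝ := (GenContFract.of α).dens n

/-- The Perez-Marco set: irrational numbers whose continued fraction denominators satisfy
`∑_{n≥1} (ln ln Q_{n+1})/Q_n < +∞`. -/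
def PerezMarcoSet : Set ℝ :=
  {α | Irrational α ∧
    Summable (fun n : ℕ => Real.log (Real.log (cfDen α (n + 2))) / cfDen α (n + 1))}

/-- The gauge function `h²_σ(t) = (ln ln(1/t))^{-2} · (ln ln ln(1/t))^{-σ}` for
`0 < t ≤ e^{-10}`, with `h²_σ(0) = 0` (the value for `t > e^{-10}` is irrelevant for the
Hausdorff measure and is set to the constant `h²_σ(e^{-10})`). -/
noncomputable def pmGauge (σ : ℝ) : ℝ≥0∞ → ℝ≥0∞ := fun t =>
  if t = 0 then 0
  else if t ≤ ENNReal.ofReal (Real.exp (-10)) then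
    ENNReal.ofReal ((Real.log (Real.log (1 / t.toReal))) ^ (-2 : ℝ) *
      (Real.log (Real.log (Real.log (1 / t.toReal)))) ^ (-σ))
  else ENNReal.ofReal ((Real.log 10) ^ (-2 : ℝ) * (Real.log (Real.log 10)) ^ (-σ))

theorem pow_le_two_mul_fib_succ (n : ℕ) : ((25 / 16 : ℝ)) ^ n ≤ 2 * (Nat.fib (n + 1) : ℝ) := by
  induction n using Nat.twoStepInduction with
  | zero => norm_num
  | one => norm_num
  | more n h0 h1 =>
    have : (Nat.fib (n + 2 + 1) : ℝ) = Nat.fib (n + 1) + Nat.fib (n + 1 + 1) := by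
      rw [Nat.fib_add_two (n := n + 1)]; push_cast; rfl
    have hp : (0 : ℝ) < (25 / 16 : ℝ) ^ n := by positivity
    rw [this]
    rw [pow_succ] at h1
    rw [pow_succ, pow_succ]
    nlinarith

theorem not_terminatedAt_of_irrational {α : ℝ} (hα : Irrational α) (n : ℕ) :
    ¬ (GenContFract.of α).TerminatedAt n := by
  intro h
  obtain ⟨q, hq⟩ := (GenContFract.terminates_iff_rat α).1 ⟨n, h⟩
  exact hα ⟨q, hq.symm⟩

theorem fib_succ_le_cfDen {α : ℝ} (hα : Irrational α) (n : ℕ) :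
    (Nat.fib (n + 1) : ℝ) ≤ cfDen α n :=
  GenContFract.succ_nth_fib_le_of_nth_den (Or.inr (not_terminatedAt_of_irrational hα _))

theorem exists_int_contsAux (α : ℝ) (n : ℕ) :
    ∃ p q : ℤ, (GenContFract.of α).contsAux n = ⟨(p : ℝ), (q : ℝ)⟩ := by
  induction n using Nat.twoStepInduction with
  | zero => exact ⟨1, 0, by simp [GenContFract.contsAux]⟩
  | one => exact ⟨⌊α⌋, 1, by simp [GenContFract.contsAux, GenContFract.of_h_eq_floor]⟩
  | more n h0 h1 =>
    obtain ⟨p0, q0, h0⟩ := h0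
    obtain ⟨p1, q1, h1⟩ := h1
    rcases hs : (GenContFract.of α).s.get? n with _ | gp
    · rw [GenContFract.contsAux_stable_step_of_terminated hs]
      exact ⟨p1, q1, h1⟩
    · obtain ⟨ha, z, hz⟩ := GenContFract.of_partNum_eq_one_and_exists_int_partDen_eq hs
      refine ⟨z * p1 + p0, z * q1 + q0, ?_⟩
      rw [GenContFract.contsAux_recurrence hs h0 h1, ha, hz]
      push_cast
      simp

/-- Each convergent is a quotient of an integer by the natural number `cfDen α n`. -/
theorem exists_convs_eq_div {α : ℝ} (hα : Irrational α) (n : ℕ) :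
    ∃ (p : ℤ) (q : ℕ), cfDen α n = q ∧ (GenContFract.of α).convs n = p / q := by
  obtain ⟨p, q, h⟩ := exists_int_contsAux α (n + 1)
  have hd : cfDen α n = q := by
    rw [cfDen, GenContFract.den_eq_conts_b, GenContFract.nth_cont_eq_succ_nth_contAux, h]
  have hq : 0 ≤ q := by
    have : (0 : ℝ) ≤ q := hd ▸ (Nat.cast_nonneg _).trans (fib_succ_le_cfDen hα n)
    exact_mod_cast this
  lift q to ℕ using hq
  refine ⟨p, q, by simpa using hd, ?_⟩
  rw [GenContFract.conv_eq_num_div_den, GenContFract.num_eq_conts_a,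
    GenContFract.den_eq_conts_b, GenContFract.nth_cont_eq_succ_nth_contAux, h]
  simp

theorem log_le_two_mul_sqrt {x : ℝ} (hx : 0 < x) : Real.log x ≤ 2 * √x := by
  have h := Real.log_le_self (Real.sqrt_nonneg x)
  rw [Real.log_sqrt hx.le] at h
  linarith

/-- If eventually `log log Q (n + 1) / Q n ≤ (log (Q n))^(-1/2)`, these quotients are summable:
either `log Q (n + 1) < 4 * log Q n` and the quotient decays geometrically, or the bound is
dominated by twice its telescoping difference. -/
theorem summable_loglog_div {Q : ℕ → ℝ} (hgrow : ∀ n, (25 / 16 : ℝ) ^ n ≤ 2 * Q n)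
    (hmono : Monotone Q)
    (h : ∀ᶠ n in atTop, Real.log (Real.log (Q (n + 1))) / Q n ≤ (√(Real.log (Q n)))⁻¹) :
    Summable fun n => Real.log (Real.log (Q (n + 1))) / Q n := by
  obtain ⟨N₀, hN₀⟩ := eventually_atTop.1 h
  set N := max N₀ 5
  have h3 : ∀ n, N ≤ n → 3 ≤ Q n := fun n hn => by
    have h5 : (25 / 16 : ℝ) ^ 5 ≤ (25 / 16 : ℝ) ^ n :=
      pow_le_pow_right₀ (by norm_num) ((le_max_right _ _).trans hn)
    have := hgrow n
    norm_num at h5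
    linarith
  have hlog : ∀ n, N ≤ n → 1 ≤ Real.log (Q n) := fun n hn => by
    rw [Real.le_log_iff_exp_le (by linarith [h3 n hn])]
    linarith [h3 n hn, Real.exp_one_lt_d9]
  set f : ℕ → ℝ := fun n => (√(Real.log (Q (n + N))))⁻¹ with hf
  have hf0 : ∀ n, 0 ≤ f n := fun n => by positivity
  have hanti : ∀ n, f (n + 1) ≤ f n := fun n => by
    have h1 := hlog (n + N) (by omega)
    have : Real.log (Q (n + N)) ≤ Real.log (Q (n + 1 + N)) :=
      Real.log_le_log (by linarith [h3 (n + N) (by omega)]) (hmono (by omega))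
    simp only [hf]
    gcongr
  have hs1 : Summable fun n => f n - f (n + 1) :=
    summable_of_sum_range_le (c := f 0) (fun n => sub_nonneg.2 (hanti n)) fun n => by
      rw [Finset.sum_range_sub']
      linarith [hf0 n]
  have hs2 : Summable fun n => (4 / 5 : ℝ) ^ (n + N) :=
    (summable_nat_add_iff N).2 (summable_geometric_of_lt_one (by norm_num) (by norm_num))
  rw [← summable_nat_add_iff N]
  refine Summable.of_nonneg_of_le (fun n => ?_) (fun n => ?_)
    ((hs2.mul_left 16).add (hs1.mul_left 2))
  · exact div_nonneg (Real.log_nonneg (hlog _ (by omega))) (by linarith [h3 (n + N) (by omega)])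
  · have hQ := h3 (n + N) (by omega)
    have hL := hlog (n + N) (by omega)
    have hL' := hlog (n + N + 1) (by omega)
    have hh := hN₀ (n + N) ((le_max_left _ _).trans (Nat.le_add_left N n))
    rcases lt_or_ge (Real.log (Q (n + N + 1))) (4 * Real.log (Q (n + N))) with hc | hc
    · have h1 : Real.log (Real.log (Q (n + N + 1))) ≤ 8 * √(Q (n + N)) := by
        have := Real.log_le_sub_one_of_pos (show 0 < Real.log (Q (n + N + 1)) by linarith)
        have := log_le_two_mul_sqrt (show 0 < Q (n + N) by linarith)
        linarith
      have h2 : (5 / 4 : ℝ) ^ (n + N) / 2 ≤ √(Q (n + N)) := by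
        apply Real.le_sqrt_of_sq_le
        rw [div_pow, ← pow_mul, mul_comm, pow_mul]
        have := hgrow (n + N)
        norm_num at this ⊢
        linarith
      have h3 : Real.log (Real.log (Q (n + N + 1))) / Q (n + N) ≤ 16 * (4 / 5 : ℝ) ^ (n + N) := by
        calc _ ≤ 8 * √(Q (n + N)) / Q (n + N) := by gcongr
          _ = 8 / √(Q (n + N)) := by
            rw [mul_div_assoc, Real.sqrt_div_self, div_eq_mul_inv]
          _ ≤ 8 / ((5 / 4 : ℝ) ^ (n + N) / 2) := by gcongr
          _ = 16 * (4 / 5 : ℝ) ^ (n + N) := by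
            rw [show (4 / 5 : ℝ) = (5 / 4)⁻¹ by norm_num, inv_pow]
            field_simp
            norm_num
      linarith [hanti n]
    · have h1 : f (n + 1) ≤ f n / 2 := by
        have h2 : 2 * √(Real.log (Q (n + N))) ≤ √(Real.log (Q (n + 1 + N))) := by
          apply Real.le_sqrt_of_sq_le
          rw [mul_pow, Real.sq_sqrt (by linarith), add_right_comm]
          linarith
        have h0 : 0 < √(Real.log (Q (n + N))) := Real.sqrt_pos.2 (by linarith)
        simp only [hf]
        calc _ ≤ (2 * √(Real.log (Q (n + N))))⁻¹ := by gcongr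
          _ = _ := by rw [mul_inv]; ring
      have : (0 : ℝ) < (4 / 5 : ℝ) ^ (n + N) := by positivity
      have : Real.log (Real.log (Q (n + N + 1))) / Q (n + N) ≤ f n := hh
      linarith

theorem summable_rpow_log_div {s : ℝ} (hs : 1 < s) :
    Summable fun n : ℕ => Real.log n ^ (-s) / n := by
  rw [← summable_condensed_iff_of_eventually_nonneg]
  · have : Summable fun k : ℕ => Real.log 2 ^ (-s) * (k : ℝ) ^ (-s) :=
      (Real.summable_nat_rpow.2 (by linarith)).mul_left _
    refine this.congr fun k => ?_
    have h2 : (0 : ℝ) < 2 ^ k := by positivity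
    push_cast
    rw [Real.log_pow, Real.mul_rpow (by positivity) (Real.log_nonneg (by norm_num))]
    field_simp
  · exact Eventually.of_forall fun n => by
      have := Real.log_natCast_nonneg n
      dsimp; positivity
  · filter_upwards [eventually_ge_atTop 2] with n hn
    have hn' : (2 : ℝ) ≤ n := by exact_mod_cast hn
    have h0 : 0 < Real.log n := Real.log_pos (by linarith)
    have hlog : Real.log n ≤ Real.log (n + 1 : ℕ) :=
      Real.log_le_log (by linarith) (by push_cast; linarith)
    have := Real.rpow_le_rpow_of_nonpos h0 hlog (show -s ≤ 0 by linarith)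
    push_cast at *
    gcongr
    linarith

/-- The abscissa `q / √(log q)` at which `log log (1/t)` is compared with the denominator `q`. -/
noncomputable def pmScale (q : ℝ) : ℝ := q / √(Real.log q)

/-- The diameter of the interval around fractions with denominator `q`. -/
noncomputable def pmRadius (q : ℝ) : ℝ := Real.exp (-Real.exp (pmScale q))

theorem sqrt_le_pmScale {q : ℝ} (hq : 1 < q) : √q ≤ pmScale q := by
  have h : √(Real.log q) ≤ √q := Real.sqrt_le_sqrt (Real.log_le_self (by linarith))
  have h0 : 0 < √(Real.log q) := Real.sqrt_pos.2 (Real.log_pos hq)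
  rw [pmScale, le_div_iff₀ h0]
  calc √q * √(Real.log q) ≤ √q * √q := by gcongr
    _ = q := Real.mul_self_sqrt (by linarith)

theorem pmRadius_le_inv {q : ℝ} (hq : 1 < q) : pmRadius q ≤ q⁻¹ := by
  have h1 : Real.log q ≤ 2 * √q := log_le_two_mul_sqrt (by linarith)
  have h2 := Real.quadratic_le_exp_of_nonneg (Real.sqrt_nonneg q)
  have h3 : Real.exp √q ≤ Real.exp (pmScale q) := Real.exp_le_exp.2 (sqrt_le_pmScale hq)
  have h4 : Real.log q ≤ Real.exp (pmScale q) := by nlinarith [sq_nonneg (√q - 1)]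
  calc pmRadius q ≤ Real.exp (-Real.log q) := Real.exp_le_exp.2 (by linarith)
    _ = q⁻¹ := by rw [Real.exp_neg, Real.exp_log (by linarith)]

theorem pmGauge_pmRadius_le {σ q : ℝ} (hσ : 0 ≤ σ) (hq : 16 ≤ q) :
    pmGauge σ (ENNReal.ofReal (pmRadius q)) ≤
      ENNReal.ofReal (2 ^ σ * (Real.log q ^ (-(σ - 1)) / q) / q) := by
  have hpos : 0 < pmRadius q := Real.exp_pos _
  have hlog : 0 < Real.log q := Real.log_pos (by linarith)
  have h4 : 4 ≤ √q := Real.le_sqrt_of_sq_le (by linarith)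
  have hs := sqrt_le_pmScale (show 1 < q by linarith)
  have h10 : 10 ≤ Real.exp (pmScale q) := by
    have := Real.quadratic_le_exp_of_nonneg (show 0 ≤ pmScale q by linarith)
    nlinarith
  have hle : pmRadius q ≤ Real.exp (-10) := Real.exp_le_exp.2 (by linarith)
  have hne : ENNReal.ofReal (pmRadius q) ≠ 0 := by simpa using hpos
  have hll : Real.log (Real.log (1 / pmRadius q)) = pmScale q := by
    rw [one_div, Real.log_inv, pmRadius, Real.log_exp, neg_neg, Real.log_exp]
  have hlll : Real.log q / 2 ≤ Real.log (pmScale q) := by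
    rw [← Real.log_sqrt (by linarith)]
    exact Real.log_le_log (by linarith) hs
  rw [pmGauge, if_neg hne, if_pos (ENNReal.ofReal_le_ofReal hle),
    ENNReal.toReal_ofReal hpos.le, hll]
  refine ENNReal.ofReal_le_ofReal ?_
  have h1 : pmScale q ^ (-2 : ℝ) = Real.log q / q ^ 2 := by
    rw [Real.rpow_neg (by linarith), Real.rpow_two, pmScale, div_pow, Real.sq_sqrt hlog.le, inv_div]
  have h2 : Real.log (pmScale q) ^ (-σ) ≤ 2 ^ σ * Real.log q ^ (-σ) := by
    calc _ ≤ (Real.log q / 2) ^ (-σ) :=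
          Real.rpow_le_rpow_of_nonpos (by positivity) hlll (by linarith)
      _ = 2 ^ σ * Real.log q ^ (-σ) := by
        rw [Real.div_rpow hlog.le (by norm_num), Real.rpow_neg (show (0 : ℝ) ≤ 2 by norm_num),
          div_inv_eq_mul, mul_comm]
  have h3 : Real.log q ^ (-(σ - 1)) = Real.log q * Real.log q ^ (-σ) := by
    rw [show -(σ - 1) = 1 + -σ by ring, Real.rpow_add hlog, Real.rpow_one]
  calc _ ≤ Real.log q / q ^ 2 * (2 ^ σ * Real.log q ^ (-σ)) := by
        rw [h1]; gcongr
    _ = _ := by rw [h3]; ring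

theorem pmGauge_zero (σ : ℝ) : pmGauge σ 0 = 0 := by simp [pmGauge]

theorem mkMetric_singleton_eq_zero {m : ℝ≥0∞ → ℝ≥0∞} (hm : m 0 = 0) (x : ℝ) :
    Measure.mkMetric m ({x} : Set ℝ) = 0 := by
  have h := Measure.mkMetric_le_liminf_tsum (β := ℕ) (ι := fun _ => Unit) ({x} : Set ℝ)
    (l := atTop) (fun _ => 0) tendsto_const_nhds (fun _ _ => {x}) (by simp)
    (by simp) m
  simpa [hm] using h

theorem exists_close_fraction_of_not_perezMarco {α : ℝ} (hα : Irrational α)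
    (hPM : α ∉ PerezMarcoSet) (N : ℕ) :
    ∃ (p : ℤ) (q : ℕ), N ≤ q ∧ |α - p / q| ≤ pmRadius q / 2 := by
  have hgrow : ∀ n, (25 / 16 : ℝ) ^ n ≤ 2 * cfDen α (n + 1) := fun n => by
    refine (pow_le_two_mul_fib_succ n).trans ?_
    have h1 : (Nat.fib (n + 1) : ℝ) ≤ Nat.fib (n + 1 + 1) := by exact_mod_cast Nat.fib_le_fib_succ
    linarith [fib_succ_le_cfDen hα (n + 1)]
  have hmono : Monotone fun n => cfDen α (n + 1) :=
    monotone_nat_of_le_succ fun n => GenContFract.of_den_mono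
  have hfreq := mt (summable_loglog_div hgrow hmono) fun h => hPM ⟨hα, h⟩
  rw [not_eventually] at hfreq
  have hev : ∀ᶠ n : ℕ in atTop, ((N + 2 : ℕ) : ℝ) ≤ cfDen α (n + 1) := by
    filter_upwards [(tendsto_pow_atTop_atTop_of_one_lt
      (show (1 : ℝ) < 25 / 16 by norm_num)).eventually_ge_atTop (2 * ((N + 2 : ℕ) : ℝ))] with n hn
    linarith [hgrow n]
  obtain ⟨n, hn, hN⟩ := (hfreq.and_eventually hev).exists
  obtain ⟨p, q, hq, hc⟩ := exists_convs_eq_div hα (n + 1)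
  have hle : cfDen α (n + 1) ≤ cfDen α (n + 2) := GenContFract.of_den_mono
  have habs := GenContFract.abs_sub_convs_le (not_terminatedAt_of_irrational hα (n + 1))
  change |α - _| ≤ 1 / (cfDen α (n + 1) * cfDen α (n + 2)) at habs
  rw [hc, hq] at habs
  rw [hq] at hN hle
  simp only [hq, not_le] at hn
  have hNq : N + 2 ≤ q := by exact_mod_cast hN
  have hq2 : (2 : ℝ) ≤ q := by exact_mod_cast (show 2 ≤ q by omega)
  refine ⟨p, q, by omega, habs.trans ?_⟩
  set Q := cfDen α (n + 1 + 1)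
  have hlogq : 0 < Real.log q := Real.log_pos (by linarith)
  have hlogQ : 0 < Real.log Q := Real.log_pos (by linarith)
  have h1 : pmScale q < Real.log (Real.log Q) := by
    rw [lt_div_iff₀ (by linarith)] at hn
    rw [pmScale, div_eq_inv_mul]
    exact hn
  have h2 : Real.exp (Real.exp (pmScale q)) < Q := by
    rw [← Real.lt_log_iff_exp_lt (by linarith), ← Real.lt_log_iff_exp_lt hlogQ]
    exact h1
  have h3 : pmRadius q / 2 = 1 / (2 * Real.exp (Real.exp (pmScale q))) := by
    rw [pmRadius, Real.exp_neg]; field_simp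
  rw [h3]
  gcongr

theorem mkMetric_bounded_part_eq_zero {σ : ℝ} (hσ : 2 < σ) (M : ℕ) :
    Measure.mkMetric (pmGauge σ)
      ({α | Irrational α ∧ α ∉ PerezMarcoSet ∧ |α| ≤ M} : Set ℝ) = 0 := by
  set P : ℕ → Finset ℤ := fun q => Finset.Icc (-((M + 1) * q : ℤ)) ((M + 1) * q) with hP
  set F : ℕ → ℝ≥0∞ := fun q => ((P q).card : ℝ≥0∞) * pmGauge σ (ENNReal.ofReal (pmRadius q))
    with hF
  set G : ℕ → ℝ := fun q => (2 * M + 3) * 2 ^ σ * (Real.log q ^ (-(σ - 1)) / q) with hG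
  have hGs : Summable G := (summable_rpow_log_div (by linarith)).mul_left _
  have hFG : ∀ q, 16 ≤ q → F q ≤ ENNReal.ofReal (G q) := fun q hq => by
    have hq' : (16 : ℝ) ≤ q := by exact_mod_cast hq
    have hcard : ((P q).card : ℝ) ≤ (2 * M + 3) * q := by
      have : (P q).card = 2 * ((M + 1) * q) + 1 := by
        rw [hP, Int.card_Icc, ← Int.toNat_natCast (2 * _ + 1)]
        congr 1; push_cast; ring
      rw [this]; push_cast; nlinarith
    calc F q ≤ ENNReal.ofReal ((2 * M + 3) * q) *
          ENNReal.ofReal (2 ^ σ * (Real.log q ^ (-(σ - 1)) / q) / q) := by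
          refine mul_le_mul' ?_ (pmGauge_pmRadius_le (by linarith) hq')
          rw [← ENNReal.ofReal_natCast]
          exact ENNReal.ofReal_le_ofReal hcard
      _ = ENNReal.ofReal (G q) := by
          rw [← ENNReal.ofReal_mul (by positivity), hG]
          congr 1
          field_simp
  have hlim : Tendsto (fun N => ∑' k, F (k + N)) atTop (nhds 0) := by
    have hGlim := ENNReal.tendsto_sum_nat_add (fun q => ENNReal.ofReal (G q))
      hGs.tsum_ofReal_ne_top
    refine tendsto_of_tendsto_of_tendsto_of_le_of_le' tendsto_const_nhds hGlim
      (Eventually.of_forall fun _ => zero_le) ?_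
    filter_upwards [eventually_ge_atTop 16] with N hN
    exact ENNReal.tsum_le_tsum fun k => hFG _ (by omega)
  have hdiam : ∀ (p : ℤ) (q : ℕ), Metric.ediam (Set.Icc ((p : ℝ) / q - pmRadius q / 2)
      (p / q + pmRadius q / 2)) = ENNReal.ofReal (pmRadius q) := fun p q => by
    rw [Real.ediam_Icc]; congr 1; ring
  have h := Measure.mkMetric_le_liminf_tsum (β := ℕ) (ι := fun N => Σ k : ℕ, P (k + N))
    ({α | Irrational α ∧ α ∉ PerezMarcoSet ∧ |α| ≤ M} : Set ℝ)
    (l := atTop) (fun N => ENNReal.ofReal ((N : ℝ)⁻¹))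
    (by simpa using ENNReal.tendsto_ofReal (tendsto_inv_atTop_nhds_zero_nat (𝕜 := ℝ)))
    (fun N i => Set.Icc (((i.2 : ℤ) : ℝ) / (i.1 + N : ℕ) - pmRadius (i.1 + N : ℕ) / 2)
      (((i.2 : ℤ) : ℝ) / (i.1 + N : ℕ) + pmRadius (i.1 + N : ℕ) / 2))
    (by
      filter_upwards [eventually_ge_atTop 2] with N hN i
      have hN' : (2 : ℝ) ≤ N := by exact_mod_cast hN
      have hq : (N : ℝ) ≤ (i.1 + N : ℕ) := by exact_mod_cast Nat.le_add_left N i.1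
      rw [hdiam]
      refine ENNReal.ofReal_le_ofReal ((pmRadius_le_inv (by linarith)).trans ?_)
      gcongr)
    (by
      filter_upwards [eventually_ge_atTop 2] with N hN α hα
      obtain ⟨hirr, hPM, hM⟩ := hα
      obtain ⟨p, q, hq, habs⟩ := exists_close_fraction_of_not_perezMarco hirr hPM N
      obtain ⟨k, rfl⟩ := Nat.exists_eq_add_of_le' hq
      have hq2 : (2 : ℝ) ≤ (k + N : ℕ) := by exact_mod_cast hN.trans hq
      have hr : pmRadius (k + N : ℕ) / 2 ≤ 1 := by
        have := pmRadius_le_inv (show 1 < ((k + N : ℕ) : ℝ) by linarith)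
        have := inv_le_one_of_one_le₀ (show 1 ≤ ((k + N : ℕ) : ℝ) by linarith)
        linarith
      have hp : |(p : ℝ) / (k + N : ℕ)| ≤ M + 1 := by
        have := abs_sub_abs_le_abs_sub ((p : ℝ) / (k + N : ℕ)) α
        rw [abs_sub_comm] at this
        linarith
      have hmem : p ∈ P (k + N) := by
        rw [abs_div, Nat.abs_cast, div_le_iff₀ (by linarith)] at hp
        rw [hP, Finset.mem_Icc, ← abs_le]
        exact_mod_cast hp
      refine Set.mem_iUnion.2 ⟨⟨k, p, hmem⟩, ?_⟩
      rw [abs_le] at habs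
      constructor <;> dsimp only <;> linarith)
    (pmGauge σ)
  refine le_antisymm (h.trans (le_of_eq ?_)) zero_le
  rw [← hlim.liminf_eq]
  congr 1
  ext N
  rw [ENNReal.tsum_sigma']
  refine tsum_congr fun k => ?_
  simp only [hdiam, hF]
  simp

/-- For every `σ > 2`, the complement of the Perez-Marco set has zero Hausdorff measure with
respect to the gauge function `h²_σ`. -/
theorem perezMarco_complement_hausdorff_zero (σ : ℝ) (hσ : 2 < σ) :
    Measure.mkMetric (pmGauge σ) (PerezMarcoSetᶜ : Set ℝ) = 0 := by
  have hsub : (PerezMarcoSetᶜ : Set ℝ) ⊆ (⋃ r : ℚ, {(r : ℝ)}) ∪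
      ⋃ M : ℕ, {α | Irrational α ∧ α ∉ PerezMarcoSet ∧ |α| ≤ M} := by
    intro α hα
    by_cases hirr : Irrational α
    · obtain ⟨M, hM⟩ := exists_nat_ge |α|
      exact Or.inr (Set.mem_iUnion.2 ⟨M, hirr, hα, hM⟩)
    · obtain ⟨r, hr⟩ := not_not.1 hirr
      exact Or.inl (Set.mem_iUnion.2 ⟨r, hr.symm⟩)
  refine measure_mono_null hsub (measure_union_null ?_ ?_)
  · exact measure_iUnion_null fun r => mkMetric_singleton_eq_zero (pmGauge_zero σ) _
  · exact measure_iUnion_null fun M => mkMetric_bounded_part_eq_zero hσ M
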